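/- arXiv:2011.11727 — 10 statements merged into one kernel-verified Lean document; each statement's English description precedes it below -/
import Mathlib

section
/- Let p be the characteristic of the finite field F_q, let β be a nonzero element of F_q, let r ≥ 1, and let γ be a nonzero element of F_{q^r}. Then the trinomial T^p − βT − γ is irreducible over F_{q^r} if and only if it has no root in F_{q^r}. -/
open Polynomial

/-- In characteristic `p`, a subfield containing one nonzero solution of `x ^ p = c * x` contains
all of them. -/
theorem Subfield.mem_of_pow_char_eq {L : Type*} [Field L] (p : ℕ) [Fact p.Prime] [CharP L p]
    (S : Subfield L) {b y c : L} (hb : b ∈ S) (hb0 : b ≠ 0) (hbp : b ^ p = c * b)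
    (hy : y ^ p = c * y) : y ∈ S := by
  have hp0 : p ≠ 0 := (Fact.out : p.Prime).ne_zero
  have hc : c ≠ 0 := by
    rintro rfl
    exact pow_ne_zero p hb0 (by simpa using hbp)
  have h : (y / b) ^ p = y / b := by
    rw [div_pow, hy, hbp, mul_div_mul_left _ _ hc]
  have h_bot : y / b ∈ (⊥ : Subfield L) := (Subfield.mem_bot_iff_pow_eq_self L p).2 h
  have h_mul := S.mul_mem ((bot_le : ⊥ ≤ S) h_bot) hb
  rwa [div_mul_cancel₀ _ hb0] at h_mul

theorem Polynomial.natDegree_X_pow_sub_C_mul_X_sub_C {K : Type*} [Field K] {n : ℕ} (hn : 1 < n)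
    (a c : K) : ((X : K[X]) ^ n - C a * X - C c).natDegree = n := by
  have h : (C a * X + C c).degree < (n : WithBot ℕ) :=
    degree_linear_le.trans_lt (by exact_mod_cast hn)
  rw [sub_sub]
  exact natDegree_eq_of_degree_eq_some (by
    rw [degree_sub_eq_left_of_degree_lt (by rwa [degree_X_pow]), degree_X_pow])

/-- Any monic factor `g` of `X ^ p - a X - c` of degree strictly between `0` and `p` forces a root, provided
`X ^ p - a X` has a nonzero root. -/
theorem Polynomial.exists_isRoot_of_dvd_X_pow_char_sub {K : Type*} [Field K] (p : ℕ)
    [Fact p.Prime] [CharP K p] {a b c : K} (hb0 : b ≠ 0) (hbp : b ^ p = a * b) {g : K[X]}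
    (hg : g.Monic) (hg0 : g.natDegree ≠ 0) (hgp : g.natDegree < p)
    (hdvd : g ∣ X ^ p - C a * X - C c) : ∃ x, (X ^ p - C a * X - C c).IsRoot x := by
  let L := AlgebraicClosure K
  have : CharP L p := charP_of_injective_algebraMap (algebraMap K L).injective p
  let S := (algebraMap K L).fieldRange
  have h_roots : ∀ y ∈ (g.map (algebraMap K L)).roots,
      y ^ p - algebraMap K L a * y - algebraMap K L c = 0 := by
    intro y hy
    have hy' := (isRoot_of_mem_roots hy).dvd (Polynomial.map_dvd (algebraMap K L) hdvd)
    simpa using hy'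
  have h_card : (g.map (algebraMap K L)).roots.card = g.natDegree := by
    rw [← (IsAlgClosed.splits (g.map (algebraMap K L))).natDegree_eq_card_roots, natDegree_map]
  obtain ⟨α, hα⟩ : ∃ α, α ∈ (g.map (algebraMap K L)).roots :=
    Multiset.card_pos_iff_exists_mem.1 (by omega)
  have h_sub : ((g.map (algebraMap K L)).roots.map (fun y => y - α)).sum ∈ S := by
    refine multiset_sum_mem _ fun z hz => ?_
    obtain ⟨y, hy, rfl⟩ := Multiset.mem_map.1 hz
    refine S.mem_of_pow_char_eq p (b := algebraMap K L b) (c := algebraMap K L a) ⟨b, rfl⟩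
      (by simpa using hb0) (by rw [← map_pow, hbp, map_mul]) ?_
    rw [sub_pow_char]
    linear_combination h_roots y hy - h_roots α hα
  have h_sum : (g.map (algebraMap K L)).roots.sum ∈ S := by
    have h := (IsAlgClosed.splits (g.map (algebraMap K L))).nextCoeff_eq_neg_sum_roots_of_monic
      (hg.map _)
    rw [nextCoeff_map (algebraMap K L).injective] at h
    exact ⟨-g.nextCoeff, by rw [map_neg, h, neg_neg]⟩
  have hd : (g.natDegree : L) ≠ 0 := by
    rw [Ne, CharP.cast_eq_zero_iff L p]
    exact Nat.not_dvd_of_pos_of_lt (Nat.pos_of_ne_zero hg0) hgp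
  obtain ⟨x, hx⟩ : α ∈ S := by
    rw [Multiset.sum_map_sub, Multiset.map_id', Multiset.map_const', Multiset.sum_replicate,
      h_card, nsmul_eq_mul] at h_sub
    have h := S.div_mem (S.sub_mem h_sum h_sub) (natCast_mem S g.natDegree)
    rwa [sub_sub_cancel, mul_div_cancel_left₀ _ hd] at h
  refine ⟨x, (algebraMap K L).injective ?_⟩
  simpa [← hx] using h_roots α hα

/-- Over a finite field, an additive polynomial `X ^ p - a X` that misses a value has a nonzero
root. -/
theorem FiniteField.exists_pow_char_eq_mul {K : Type*} [Field K] [Finite K] (p : ℕ)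
    [Fact p.Prime] [CharP K p] {a c : K} (h : ∀ x, x ^ p - a * x ≠ c) :
    ∃ b : K, b ≠ 0 ∧ b ^ p = a * b := by
  by_contra! hb
  have h_inj : Function.Injective fun x : K => x ^ p - a * x := by
    intro x y hxy
    by_contra hne
    refine hb (x - y) (sub_ne_zero.2 hne) ?_
    rw [sub_pow_char]
    linear_combination hxy
  obtain ⟨x, hx⟩ := Finite.surjective_of_injective h_inj c
  exact h x hx

/-- Over a finite field of characteristic `p`, the trinomial `X ^ p - a X - c` is irreducible iff
it has no root. -/
theorem FiniteField.irreducible_X_pow_char_sub_iff {K : Type*} [Field K] [Finite K] (p : ℕ)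
    [Fact p.Prime] [CharP K p] (a c : K) :
    Irreducible ((X : K[X]) ^ p - C a * X - C c) ↔
      ∀ x : K, ¬ ((X : K[X]) ^ p - C a * X - C c).IsRoot x := by
  have hp : 1 < p := (Fact.out : p.Prime).one_lt
  have h_deg := natDegree_X_pow_sub_C_mul_X_sub_C hp a c
  constructor
  · intro hirr x hx
    have h_one := natDegree_eq_of_degree_eq_some (n := 1)
      (degree_eq_one_of_irreducible_of_root hirr hx)
    omega
  · intro hroot
    obtain ⟨b, hb0, hbp⟩ := exists_pow_char_eq_mul p (a := a) (c := c) fun x hx =>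
      hroot x (by simp [IsRoot, hx])
    have hf0 : (X : K[X]) ^ p - C a * X - C c ≠ 0 := by
      intro h
      rw [h, natDegree_zero] at h_deg
      omega
    have h_unit : ¬ IsUnit ((X : K[X]) ^ p - C a * X - C c) := by
      intro h
      have := natDegree_eq_zero_of_isUnit h
      omega
    obtain ⟨g, hg, hg_irr, hdvd⟩ := exists_monic_irreducible_factor _ h_unit
    have h_le := natDegree_le_of_dvd hdvd hf0
    by_cases hlt : g.natDegree < p
    · obtain ⟨x, hx⟩ := exists_isRoot_of_dvd_X_pow_char_sub p hb0 hbp hg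
        hg_irr.natDegree_pos.ne' hlt hdvd
      exact absurd hx (hroot x)
    · exact (associated_of_dvd_of_natDegree_le hdvd hf0 (by omega)).irreducible hg_irr

/-- Let `p` be the characteristic of the finite field `F = F_q`
(`q = p^m`), let `β` be a nonzero element of `F_q`, let `r ≥ 1`, and let `γ` be a
nonzero element of `K = F_{q^r}`.  Then the trinomial `T^p − βT − γ` is irreducible
over `F_{q^r}` if and only if it has no root in `F_{q^r}`. -/
theorem stmt0 (p m r : ℕ) (hp : p.Prime) (hm : 0 < m) (hr : 0 < r)
    (F K : Type*) [Field F] [Fintype F] [Field K] [Fintype K] [Algebra F K]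
    (hF : Fintype.card F = p ^ m) (hK : Module.finrank F K = r)
    (β : F) (hβ : β ≠ 0) (γ : K) (hγ : γ ≠ 0) :
    Irreducible ((X : Polynomial K) ^ p - C (algebraMap F K β) * X - C γ) ↔
      ∀ x : K, ¬ ((X : Polynomial K) ^ p - C (algebraMap F K β) * X - C γ).IsRoot x := by
  have : Fact p.Prime := ⟨hp⟩
  have : CharP F p := charP_of_card_eq_prime_pow hF
  have : CharP K p := charP_of_injective_algebraMap (algebraMap F K).injective p
  exact FiniteField.irreducible_X_pow_char_sub_iff p (algebraMap F K β) γ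
end

section
/- Let G be an additive subgroup of F_q and set [1]_G = ∏_{a ∈ G} (T − a) ∈ F_q[T]. A monic polynomial f ∈ F_q[T] is G-fixed if and only if there exists some g ∈ F_q[T] such that f = g([1]_G), i.e., f is the composition of g with [1]_G. -/
open Polynomial

/-- The monic polynomial whose roots are the elements of a finite additive subgroup is invariant
under translation by the subgroup. -/
theorem prod_X_sub_C_comp_X_add_C {F : Type*} [CommRing F] (G : AddSubgroup F) (s : Finset F)
    (hs : ∀ a, a ∈ s ↔ a ∈ G) {b : F} (hb : b ∈ G) :
    (∏ a ∈ s, (X - C a)).comp (X + C b) = ∏ a ∈ s, (X - C a) := by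
  rw [prod_comp]
  refine Finset.prod_nbij' (fun a => a - b) (fun a => a + b) ?_ ?_ ?_ ?_ ?_
  · intro a ha
    exact (hs _).2 (G.sub_mem ((hs a).1 ha) hb)
  · intro a ha
    exact (hs _).2 (G.add_mem ((hs a).1 ha) hb)
  · intro a _
    simp
  · intro a _
    simp
  · intro a _
    simp only [sub_comp, X_comp, C_comp, C_sub]
    ring

/-- A polynomial invariant under translation by a finite additive subgroup is a polynomial in
`∏ a ∈ G, (X - C a)`. -/
theorem exists_eq_comp_prod_X_sub_C {F : Type*} [Field F] (G : AddSubgroup F) (s : Finset F)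
    (hs : ∀ a, a ∈ s ↔ a ∈ G) (f : F[X]) (hf : ∀ a ∈ G, f.comp (X + C a) = f) :
    ∃ g : F[X], f = g.comp (∏ a ∈ s, (X - C a)) := by
  induction hn : f.natDegree using Nat.strong_induction_on generalizing f with
  | _ n ih =>
  set P : F[X] := ∏ a ∈ s, (X - C a) with hP
  have hPm : P.Monic := monic_prod_of_monic _ _ fun a _ => monic_X_sub_C a
  have hPd : 0 < P.natDegree := by
    rw [hP, natDegree_finsetProd_X_sub_C_eq_card]
    exact Finset.card_pos.2 ⟨0, (hs 0).2 G.zero_mem⟩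
  have hdvd : P ∣ f - C (f.eval 0) := by
    refine Finset.prod_dvd_of_coprime
      (fun a _ b _ hab => pairwise_coprime_X_sub_C Function.injective_id hab) fun a ha => ?_
    rw [dvd_iff_isRoot, IsRoot, eval_sub, eval_C, sub_eq_zero]
    conv_rhs => rw [← hf a ((hs a).1 ha)]
    simp
  obtain ⟨h, hh⟩ := hdvd
  have hfh : f = P * h + C (f.eval 0) := by rw [← hh]; ring
  by_cases h0 : h = 0
  · exact ⟨C (f.eval 0), by simpa [h0] using hfh⟩
  have hhfix : ∀ a ∈ G, h.comp (X + C a) = h := by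
    intro a ha
    apply mul_left_cancel₀ hPm.ne_zero
    have key := congrArg (fun p : F[X] => p.comp (X + C a)) hh
    simp only [sub_comp, C_comp, mul_comp, hf a ha] at key
    rw [hP, prod_X_sub_C_comp_X_add_C G s hs ha, ← hP] at key
    rw [← key, hh]
  have hdeg : h.natDegree < n := by
    have hd := congrArg natDegree hh
    rw [natDegree_sub_C, hPm.natDegree_mul' h0] at hd
    omega
  obtain ⟨g, hg⟩ := ih _ hdeg h hhfix rfl
  refine ⟨X * g + C (f.eval 0), ?_⟩
  rw [add_comp, mul_comp, X_comp, C_comp, ← hg]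
  exact hfh

/-- Let `G` be an additive subgroup of `F_q` and set
`[1]_G = ∏_{a ∈ G} (T − a)`.  A monic polynomial `f ∈ F_q[T]` is `G`-fixed
(i.e. `f(T + a) = f(T)` for all `a ∈ G`) if and only if there is some `g ∈ F_q[T]`
such that `f = g([1]_G)`. -/
theorem stmt3 (F : Type*) [Field F] [Fintype F] (G : AddSubgroup F)
    (f : Polynomial F) (hf : f.Monic) :
    (∀ a ∈ G, f.comp (X + C a) = f) ↔
      ∃ g : Polynomial F,
        f = g.comp (∏ a ∈ (Set.toFinite (G : Set F)).toFinset, (X - C a)) := by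
  have hs : ∀ a, a ∈ (Set.toFinite (G : Set F)).toFinset ↔ a ∈ G := by simp
  constructor
  · exact exists_eq_comp_prod_X_sub_C G _ hs f
  · rintro ⟨g, rfl⟩ a ha
    rw [comp_assoc, prod_X_sub_C_comp_X_add_C G _ hs ha]
end

section
/- Let G be an additive subgroup of (F_q, +) of order p, so G = χ·F_p for some nonzero χ ∈ F_q, and let f ∈ F_q[T] be a G-fixed monic irreducible polynomial of degree ps for some s ≥ 1. Then, over the extension field F_{q^s}, f factors as a product of s monic irreducible polynomials, each of the form T^p − χ^{p−1}T − γ with γ ∈ F_{q^s}. -/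
open Polynomial

namespace Polynomial

/-- A polynomial of degree less than the characteristic that is invariant under a nontrivial
translation is constant. -/
theorem eq_C_of_taylor_eq_self_of_natDegree_lt {F : Type*} [Field F] {p : ℕ} [CharP F p]
    {χ : F} (hχ : χ ≠ 0) {r : F[X]} (hr : taylor χ r = r) (hdeg : r.natDegree < p) :
    r = C (r.eval 0) := by
  have hmul (n : ℕ) : r.eval (n * χ) = r.eval 0 := by
    induction n with
    | zero => simp
    | succ n ih =>
      rw [← ih]
      nth_rw 2 [← hr]
      rw [taylor_eval]
      congr 1
      push_cast
      ring
  rw [← sub_eq_zero]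
  refine eq_zero_of_natDegree_lt_card_of_eval_eq_zero (ι := Fin p) _
    (f := fun i ↦ ((i : ℕ) : F) * χ) (fun i j hij ↦ ?_) (fun i ↦ by simp [hmul]) (by simpa)
  have hij' : ((i : ℕ) : F) = (j : ℕ) := mul_right_cancel₀ hχ hij
  rw [CharP.natCast_eq_natCast F p] at hij'
  exact Fin.ext (Nat.ModEq.eq_of_lt_of_lt hij' i.2 j.2)

section

variable {R : Type*} [CommRing R] {n : ℕ}

theorem monic_X_pow_sub_C_mul_X (hn : 1 < n) (a : R) : ((X : R[X]) ^ n - C a * X).Monic :=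
  monic_X_pow_sub ((degree_C_mul_X_le a).trans_lt (by exact_mod_cast hn))

theorem natDegree_X_pow_sub_C_mul_X [Nontrivial R] (hn : 1 < n) (a : R) :
    ((X : R[X]) ^ n - C a * X).natDegree = n := by
  rw [natDegree_sub_eq_left_of_natDegree_lt, natDegree_X_pow]
  rw [natDegree_X_pow]
  exact (natDegree_C_mul_le a X).trans_lt (by rwa [natDegree_X])

theorem natDegree_X_pow_sub_C_mul_X_sub_C_s4 [Nontrivial R] (hn : 1 < n) (a b : R) :
    ((X : R[X]) ^ n - C a * X - C b).natDegree = n := by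
  rw [natDegree_sub_C, natDegree_X_pow_sub_C_mul_X hn]

theorem monic_X_pow_sub_C_mul_X_sub_C (hn : 1 < n) (a b : R) :
    ((X : R[X]) ^ n - C a * X - C b).Monic := by
  rw [sub_sub]
  exact monic_X_pow_sub (degree_linear_le.trans_lt (by exact_mod_cast hn))

end

/-- A polynomial invariant under translation by `χ` is a polynomial in `T ^ p - χ ^ (p - 1) T`. -/
theorem exists_eq_comp_of_taylor_eq_self {F : Type*} [Field F] {p : ℕ} [Fact p.Prime] [CharP F p]
    {χ : F} (hχ : χ ≠ 0) {f : F[X]} (hf : taylor χ f = f) :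
    ∃ h : F[X], f = h.comp (X ^ p - C (χ ^ (p - 1)) * X) := by
  have hp : p.Prime := Fact.out
  set g : F[X] := X ^ p - C (χ ^ (p - 1)) * X with hg
  have hgm : g.Monic := monic_X_pow_sub_C_mul_X hp.one_lt _
  have hgd : g.natDegree = p := natDegree_X_pow_sub_C_mul_X hp.one_lt _
  have hgt : taylor χ g = g := by
    have : (C χ : F[X]) ^ p = C χ ^ (p - 1) * C χ := by
      rw [← pow_succ, Nat.sub_add_cancel hp.one_le]
    simp only [hg, taylor_apply, sub_comp, mul_comp, pow_comp, X_comp, C_comp, add_pow_char,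
      C_pow, this]
    ring
  induction hn : f.natDegree using Nat.strong_induction_on generalizing f with
  | _ n ih =>
  by_cases hlt : f.natDegree < p
  · exact ⟨C (f.eval 0), by
      rw [C_comp]
      exact eq_C_of_taylor_eq_self_of_natDegree_lt hχ hf hlt⟩
  have huniq := div_modByMonic_unique (taylor χ (f /ₘ g)) (taylor χ (f %ₘ g)) hgm (f := f) ⟨by
      conv_rhs => rw [← hf, ← modByMonic_add_div f g, map_add, taylor_mul, hgt],
    by rw [degree_taylor]; exact degree_modByMonic_lt f hgm⟩
  have hr := eq_C_of_taylor_eq_self_of_natDegree_lt (p := p) hχ huniq.2.symm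
    (hgd ▸ natDegree_modByMonic_lt f hgm fun h ↦ by simp [h, hp.ne_zero.symm] at hgd)
  obtain ⟨k, hk⟩ := ih (f /ₘ g).natDegree
    (by rw [natDegree_divByMonic f hgm, hgd]; have := hp.pos; omega) huniq.1.symm rfl
  refine ⟨X * k + C ((f %ₘ g).eval 0), ?_⟩
  rw [add_comp, mul_comp, X_comp, C_comp, ← hk, ← hr, add_comm, modByMonic_add_div]

theorem irreducible_of_irreducible_comp {F : Type*} [Field F] {h g : F[X]}
    (hg : g.natDegree ≠ 0) (hi : Irreducible (h.comp g)) : Irreducible h := by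
  have : IsLocalHom (compRingHom g) := ⟨fun a ha ↦ by
    have ha0 : a ≠ 0 := fun h0 ↦ by simp [h0] at ha
    have hd := natDegree_eq_zero_of_isUnit ha
    rw [coe_compRingHom_apply, natDegree_comp, mul_eq_zero, or_iff_left hg] at hd
    rw [isUnit_iff_degree_eq_zero, degree_eq_natDegree ha0, hd, Nat.cast_zero]⟩
  exact Irreducible.of_map (f := compRingHom g) hi

theorem irreducible_of_dvd_map_of_natDegree_eq {F K : Type*} [Field F] [Field K] [Algebra F K]
    [FiniteDimensional F K] {f : F[X]} (hf : Irreducible f) {g : K[X]}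
    (hg : g ∣ f.map (algebraMap F K)) (hg0 : g.natDegree ≠ 0)
    (hdeg : f.natDegree = g.natDegree * Module.finrank F K) : Irreducible g := by
  obtain ⟨P, hP, hPg⟩ := exists_irreducible_of_natDegree_ne_zero hg0
  have : Fact (Irreducible P) := ⟨hP⟩
  have hfin : Module.finrank K (AdjoinRoot P) = P.natDegree := by
    rw [(AdjoinRoot.powerBasis hP.ne_zero).finrank, AdjoinRoot.powerBasis_dim]
  have : FiniteDimensional K (AdjoinRoot P) := (AdjoinRoot.powerBasis hP.ne_zero).finite
  have : FiniteDimensional F (AdjoinRoot P) := .trans F K _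
  have hroot : aeval (AdjoinRoot.root P) f = 0 := by
    rw [← aeval_map_algebraMap K, AdjoinRoot.aeval_eq, AdjoinRoot.mk_eq_zero]
    exact hPg.trans hg
  have hle : f.natDegree ≤ Module.finrank F (AdjoinRoot P) := by
    have := minpoly.natDegree_le (A := F) (AdjoinRoot.root P)
    rwa [← minpoly.eq_of_irreducible hf hroot, natDegree_mul_C (by simp [hf.ne_zero])] at this
  rw [hdeg, ← Module.finrank_mul_finrank F K (AdjoinRoot P), hfin, mul_comm] at hle
  exact (associated_of_dvd_of_natDegree_le hPg (fun h ↦ by simp [h] at hg0)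
    (Nat.le_of_mul_le_mul_left hle Module.finrank_pos)).irreducible hP

theorem splits_map_of_irreducible_of_natDegree_dvd_finrank {F K : Type*} [Field F] [Field K]
    [Finite K] [Algebra F K] {h : F[X]} (hh : Irreducible h)
    (hdvd : h.natDegree ∣ Module.finrank F K) : (h.map (algebraMap F K)).Splits := by
  have : Finite F := .of_injective _ (algebraMap F K).injective
  rw [hh.natDegree_dvd_iff_dvd_X_pow_card_pow_sub_X, ← Module.natCard_eq_pow_finrank] at hdvd
  have hdvd' := map_dvd (algebraMap F K) hdvd
  rw [Polynomial.map_sub, Polynomial.map_pow, map_X] at hdvd'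
  exact (_root_.Polynomial.splits_X_pow_nat_card_sub_X (K := K)).of_dvd
    (FiniteField.X_pow_card_sub_X_ne_zero K Finite.one_lt_card) hdvd'

end Polynomial

/-- Let `G = χ·F_p` (the additive subgroup of `F_q` of order `p`
generated by a nonzero `χ ∈ F_q`), and let `f ∈ F_q[T]` be a `G`-fixed monic
irreducible polynomial of degree `p·s`.  Then, over the extension field `F_{q^s}`,
`f` factors as a product of `s` monic irreducible polynomials, each of the form
`T^p − χ^{p−1}T − γ` with `γ ∈ F_{q^s}`. -/
theorem stmt4 (p m s : ℕ) (hp : p.Prime) (hm : 0 < m) (hs : 0 < s)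
    (F K : Type*) [Field F] [Fintype F] [Field K] [Fintype K] [Algebra F K]
    (hF : Fintype.card F = p ^ m) (hK : Module.finrank F K = s)
    (χ : F) (hχ : χ ≠ 0)
    (f : Polynomial F) (hmon : f.Monic) (hirr : Irreducible f)
    (hdeg : f.natDegree = p * s)
    (hfix : ∀ a ∈ AddSubgroup.closure {χ}, f.comp (X + C a) = f) :
    ∃ γ : Fin s → K,
      (∀ i, ((X : Polynomial K) ^ p
          - C (algebraMap F K (χ ^ (p - 1))) * X - C (γ i)).Monic ∧
        Irreducible ((X : Polynomial K) ^ p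
          - C (algebraMap F K (χ ^ (p - 1))) * X - C (γ i))) ∧
      f.map (algebraMap F K) =
        ∏ i, ((X : Polynomial K) ^ p
          - C (algebraMap F K (χ ^ (p - 1))) * X - C (γ i)) := by
  have : Fact p.Prime := ⟨hp⟩
  have : CharP F p := charP_of_card_eq_prime_pow hF
  obtain ⟨h, hh⟩ := exists_eq_comp_of_taylor_eq_self (p := p) hχ
    (hfix χ (AddSubgroup.subset_closure rfl))
  set g : F[X] := X ^ p - C (χ ^ (p - 1)) * X with hg
  have hgm : g.Monic := monic_X_pow_sub_C_mul_X hp.one_lt _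
  have hgd : g.natDegree = p := natDegree_X_pow_sub_C_mul_X hp.one_lt _
  have hg0 : g.natDegree ≠ 0 := hgd ▸ hp.ne_zero
  have hhirr : Irreducible h := irreducible_of_irreducible_comp hg0 (hh ▸ hirr)
  have hhm : h.Monic := by
    simpa [hh, Monic, leadingCoeff_comp hg0, hgm.leadingCoeff] using hmon
  have hhd : h.natDegree = s := by
    rw [hh, natDegree_comp, hgd, mul_comm] at hdeg
    exact Nat.eq_of_mul_eq_mul_left hp.pos hdeg
  have hsplit : (h.map (algebraMap F K)).Splits :=
    splits_map_of_irreducible_of_natDegree_dvd_finrank hhirr (by rw [hhd, hK])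
  set l := (h.map (algebraMap F K)).roots.toList with hl
  have hlen : l.length = s := by
    rw [hl, Multiset.length_toList, ← hsplit.natDegree_eq_card_roots, natDegree_map, hhd]
  have hprod : f.map (algebraMap F K) = ∏ i : Fin s, ((X : Polynomial K) ^ p
      - C (algebraMap F K (χ ^ (p - 1))) * X - C (l[i.1]'(by omega))) := by
    have hmap : h.map (algebraMap F K) = (l.map (X - C ·)).prod := by
      rw [hsplit.eq_prod_roots_of_monic (hhm.map _), ← Multiset.prod_coe, ← Multiset.map_coe, hl,
        Multiset.coe_toList]
    have hmap' : h.map (algebraMap F K) = ∏ i : Fin s, (X - C (l[i.1]'(by omega))) := by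
      subst hlen
      rw [hmap, ← Fin.prod_univ_fun_getElem]
    rw [hh, map_comp, hmap', prod_comp]
    simp [hg]
  have : FiniteDimensional F K := .of_finrank_pos (hK ▸ hs)
  refine ⟨fun i ↦ l[i.1]'(by omega), fun i ↦
    ⟨monic_X_pow_sub_C_mul_X_sub_C hp.one_lt _ _, ?_⟩, hprod⟩
  have hd := natDegree_X_pow_sub_C_mul_X_sub_C_s4 hp.one_lt (algebraMap F K (χ ^ (p - 1)))
    (l[i.1]'(by omega))
  refine irreducible_of_dvd_map_of_natDegree_eq hirr ?_ (by rw [hd]; exact hp.ne_zero)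
    (by rw [hd, hdeg, hK])
  rw [hprod]
  exact Finset.dvd_prod_of_mem _ (Finset.mem_univ i)
end

section
/- Let s ≥ 0 and ℓ be integers with 0 ≤ ℓ < d, and let Q be a monic irreducible polynomial in F_q[T] of degree d. Then F_{sd+ℓ} ≡ (−1)^{sd}·F_ℓ (mod Q), where F_i is defined by F_0 = 1 and F_i = (−1)^i + (T^{q^i} − T)·F_{i−1} for i ≥ 1. -/
open Polynomial

/-- The sequence of polynomials `F_0 = 1`, `F_i = (−1)^i + (T^{q^i} − T)·F_{i−1}`. -/
noncomputable def Fseq (q : ℕ) (K : Type*) [Field K] : ℕ → Polynomial K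
  | 0 => 1
  | i + 1 => (-1 : Polynomial K) ^ (i + 1) + (X ^ q ^ (i + 1) - X) * Fseq q K i

theorem dvd_Fseq_add_sub {F : Type*} [Field F] {q m : ℕ} {Q : Polynomial F}
    (h : Q ∣ X ^ q ^ m - X) (ℓ : ℕ) :
    Q ∣ Fseq q F (m + ℓ) - (-1) ^ m * Fseq q F ℓ := by
  induction ℓ with
  | zero =>
    cases m with
    | zero => simp [Fseq]
    | succ n => simpa [Fseq] using h.mul_right (Fseq q F n)
  | succ k ih =>
    have hpow : Q ∣ X ^ q ^ (m + (k + 1)) - X ^ q ^ (k + 1) := by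
      rw [pow_add, pow_mul]
      exact h.trans (sub_dvd_pow_sub_pow _ _ _)
    have hsum := (ih.mul_left (X ^ q ^ (m + (k + 1)) - X)).add
      (hpow.mul_right ((-1) ^ m * Fseq q F k))
    rw [← add_assoc] at hsum ⊢
    convert hsum using 1
    simp only [Fseq]
    ring

/-- Let `0 ≤ ℓ < d` and let `Q` be a monic irreducible polynomial in
`F_q[T]` of degree `d`.  Then `F_{sd+ℓ} ≡ (−1)^{sd}·F_ℓ (mod Q)`. -/
theorem stmt5 (q d s ℓ : ℕ) (F : Type*) [Field F] [Fintype F]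
    (hF : Fintype.card F = q)
    (Q : Polynomial F) (hmon : Q.Monic) (hirr : Irreducible Q)
    (hdeg : Q.natDegree = d) (hℓ : ℓ < d) :
    Q ∣ (Fseq q F (s * d + ℓ) - (-1) ^ (s * d) * Fseq q F ℓ) := by
  apply dvd_Fseq_add_sub
  rw [← hF, ← Nat.card_eq_fintype_card]
  exact hirr.natDegree_dvd_iff_dvd_X_pow_card_pow_sub_X.mp (hdeg ▸ dvd_mul_left d s)
end

section
/- Let q = p^m ≥ 3, s ≥ 1, let χ ∈ F_q be nonzero and set G = χ·F_p. A monic irreducible polynomial P ∈ F_q[T] is a G-fixed c-Wieferich prime of degree ps if and only if there exists α ∈ F_{q^s} of degree s over F_q such that Tr_{F_{q^s}/F_q}(α) is a nonzero element of G, F_{ps−1} ≡ 0 (mod T^q − T − α) in F_{q^s}[T], and P divides ∏_{i=1}^{s} (T^q − T − α^{q^i}). -/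
open Polynomial

theorem comp_X_add_C_eq_self {F L : Type*} [Field F] [Field L] [Algebra F L] {P : F[X]}
    (hP : Irreducible P) (hmon : P.Monic) {θ : L} {a : F}
    (hθ : aeval θ P = 0) (hθa : aeval (θ + algebraMap F L a) P = 0) :
    P.comp (X + C a) = P := by
  have h1 := minpoly.eq_of_irreducible_of_monic hP hθ hmon
  have h2 := minpoly.eq_of_irreducible_of_monic hP hθa hmon
  rw [minpoly.add_algebraMap, ← h1] at h2
  nth_rewrite 1 [h2]
  rw [comp_assoc]
  simp

theorem Fseq_map {F K : Type*} [Field F] [Field K] [Algebra F K] (q n : ℕ) :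
    Fseq q K n = (Fseq q F n).map (algebraMap F K) := by
  induction n with
  | zero => simp [Fseq]
  | succ n ih => simp [Fseq, ih]

section Frobenius

variable {F L : Type*} [Field F] [Fintype F] [Field L] [Algebra F L]

local notation "φ" => FiniteField.frobeniusAlgHom F L

theorem frobeniusAlgHom_pow_apply (n : ℕ) (x : L) : (φ ^ n) x = x ^ Fintype.card F ^ n := by
  rw [AlgHom.coe_pow, FiniteField.coe_frobeniusAlgHom, pow_iterate]

theorem mem_range_algebraMap_of_pow_card_eq {x : L} (h : x ^ Fintype.card F = x) :
    ∃ a : F, algebraMap F L a = x := by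
  have hne : (X ^ Fintype.card F - X : F[X]) ≠ 0 :=
    FiniteField.X_pow_card_sub_X_ne_zero F Fintype.one_lt_card
  have hsp : (X ^ Fintype.card F - X : F[X]).Splits := by
    rw [splits_iff_card_roots, FiniteField.roots_X_pow_card_sub_X,
      FiniteField.X_pow_card_sub_X_natDegree_eq F Fintype.one_lt_card]
    rfl
  have hroot : ((X ^ Fintype.card F - X : F[X]).map (algebraMap F L)).IsRoot x := by simp [h]
  exact hsp.mem_range_of_isRoot hne hroot

theorem frobeniusAlgHom_pow_eq_self_iff {P : F[X]} (hP : Irreducible P) {θ : L}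
    (hθ : aeval θ P = 0) (n : ℕ) : (φ ^ n) θ = θ ↔ P.natDegree ∣ n := by
  rw [hP.natDegree_dvd_iff_dvd_X_pow_card_pow_sub_X, ← hP.dvd_iff_aeval_eq_zero hθ,
    frobeniusAlgHom_pow_apply, Nat.card_eq_fintype_card]
  simp [sub_eq_zero]

theorem aeval_frobeniusAlgHom_pow (P : F[X]) (θ : L) (n : ℕ) :
    aeval ((φ ^ n) θ) P = (φ ^ n) (aeval θ P) :=
  aeval_algHom_apply _ _ _

/-- The roots of an irreducible polynomial over a finite field form one Frobenius orbit. -/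
theorem exists_frobeniusAlgHom_pow_eq {P : F[X]} (hP : Irreducible P) {θ θ' : L}
    (hθ : aeval θ P = 0) (hθ' : aeval θ' P = 0) : ∃ j : ℕ, (φ ^ j) θ = θ' := by
  classical
  have hmap : P.map (algebraMap F L) ≠ 0 := map_ne_zero hP.ne_zero
  have hinj : Set.InjOn (fun j : ℕ => (φ ^ j) θ) (Finset.range P.natDegree) := by
    have key : ∀ i j : ℕ, i ≤ j → j < P.natDegree → (φ ^ i) θ = (φ ^ j) θ → i = j := by
      intro i j hij hj h
      obtain ⟨k, rfl⟩ := Nat.exists_eq_add_of_le hij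
      rw [pow_add, AlgHom.mul_apply] at h
      have hk := (frobeniusAlgHom_pow_eq_self_iff hP hθ k).1 ((φ ^ i).injective h).symm
      have := Nat.eq_zero_of_dvd_of_lt hk (by omega)
      omega
    intro i hi j hj h
    simp only [Finset.coe_range, Set.mem_Iio] at hi hj
    rcases le_total i j with hij | hij
    · exact key i j hij hj h
    · exact (key j i hij hi h.symm).symm
  have hsub : (Finset.range P.natDegree).image (fun j : ℕ => (φ ^ j) θ) ⊆
      (P.map (algebraMap F L)).roots.toFinset := by
    intro x hx
    obtain ⟨j, -, rfl⟩ := Finset.mem_image.1 hx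
    rw [Multiset.mem_toFinset, mem_roots hmap, IsRoot, eval_map_algebraMap,
      aeval_frobeniusAlgHom_pow, hθ, map_zero]
  have heq := Finset.eq_of_subset_of_card_le hsub (by
    rw [Finset.card_image_of_injOn hinj, Finset.card_range]
    exact (Multiset.toFinset_card_le _).trans ((card_roots' _).trans natDegree_map_le))
  have hmem : θ' ∈ (P.map (algebraMap F L)).roots.toFinset := by
    rw [Multiset.mem_toFinset, mem_roots hmap, IsRoot, eval_map_algebraMap, hθ']
  rw [← heq] at hmem
  obtain ⟨j, -, hj⟩ := Finset.mem_image.1 hmem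
  exact ⟨j, hj⟩

theorem frobeniusAlgHom_pow_mul_apply {n : ℕ} {θ t : L} (h : (φ ^ n) θ = θ + t)
    (ht : (φ ^ n) t = t) (k : ℕ) : (φ ^ (n * k)) θ = θ + k • t := by
  induction k with
  | zero => simp
  | succ k ih =>
    rw [Nat.mul_succ, add_comm, pow_add, AlgHom.mul_apply, ih, map_add, h, map_nsmul, ht,
      succ_nsmul]
    abel

theorem frobeniusAlgHom_pow_apply_of_modEq {s : ℕ} {α : L} (h : (φ ^ s) α = α) {a b : ℕ}
    (hab : a ≡ b [MOD s]) : (φ ^ a) α = (φ ^ b) α := by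
  have key : ∀ c : ℕ, (φ ^ c) α = (φ ^ (c % s)) α := by
    intro c
    have h0 := frobeniusAlgHom_pow_mul_apply (h.trans (add_zero α).symm) (map_zero _) (c / s)
    conv_lhs => rw [← Nat.mod_add_div c s, pow_add, AlgHom.mul_apply, h0]
    simp
  rw [key a, key b, hab]

theorem frobeniusAlgHom_pow_eq_add_sum (θ : L) (n : ℕ) :
    (φ ^ n) θ = θ + ∑ i ∈ Finset.range n, (φ ^ i) (φ θ - θ) := by
  induction n with
  | zero => simp
  | succ n ih =>
    rw [Finset.sum_range_succ, ← add_assoc, ← ih, map_sub, ← AlgHom.mul_apply, ← pow_succ]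
    ring

theorem aeval_add_algebraMap_Fseq (θ : L) (a : F) (n : ℕ) :
    aeval (θ + algebraMap F L a) (Fseq (Fintype.card F) F n) =
      aeval θ (Fseq (Fintype.card F) F n) := by
  induction n with
  | zero => simp [Fseq]
  | succ n ih =>
    have h : ∀ x : L, aeval x (X ^ Fintype.card F ^ (n + 1) - X : F[X]) = (φ ^ (n + 1)) x - x := by
      intro x
      simp [frobeniusAlgHom_pow_apply]
    simp only [Fseq, map_add, map_mul, ih, h, AlgHom.commutes, map_pow, map_neg, map_one]
    ring

theorem frobeniusAlgHom_apply_eq_pow (x : L) : φ x = x ^ Fintype.card F := rfl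

end Frobenius

theorem dvd_of_forall_aeval_eq_zero {K : Type*} (L : Type*) [Field K] [Field L] [IsAlgClosed L]
    [Algebra K L] {f g : K[X]} (hf : f.Separable)
    (h : ∀ x : L, aeval x f = 0 → aeval x g = 0) : f ∣ g := by
  rcases eq_or_ne g 0 with rfl | hg
  · exact dvd_zero f
  have hf' : f.map (algebraMap K L) ≠ 0 := map_ne_zero hf.ne_zero
  have hg' : g.map (algebraMap K L) ≠ 0 := map_ne_zero hg
  rw [← map_dvd_map' (algebraMap K L), IsAlgClosed.dvd_iff_roots_le_roots hf' hg',
    Multiset.le_iff_subset (nodup_roots hf.map)]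
  intro x hx
  rw [mem_roots hf', IsRoot, eval_map_algebraMap] at hx
  rw [mem_roots hg', IsRoot, eval_map_algebraMap]
  exact h x hx

theorem separable_X_pow_card_sub_X_sub_C (F : Type*) {K : Type*} [Field F] [Fintype F] [Field K]
    [Algebra F K] (α : K) : ((X : K[X]) ^ Fintype.card F - X - C α).Separable := by
  have h0 : (Fintype.card F : K) = 0 := by
    rw [← map_natCast (algebraMap F K), FiniteField.cast_card_eq_zero, map_zero]
  rw [separable_def]
  convert! isCoprime_one_right.neg_right (R := K[X]) using 1
  rw [derivative_sub, derivative_C, derivative_sub, derivative_X, derivative_X_pow, h0, C_0,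
    zero_mul, zero_sub, sub_zero]

section Wieferich

variable {p s : ℕ} {F K : Type*} [Field F] [Fintype F] [Field K] [Fintype K] [Algebra F K]
  [CharP F p] {χ : F} {P : F[X]}

local notation "L" => AlgebraicClosure K
local notation "φ" => FiniteField.frobeniusAlgHom F (AlgebraicClosure K)

theorem exists_natDegree_minpoly_eq_of_fixed (hp : p.Prime) (hs : 0 < s)
    (hK : Module.finrank F K = s) (hχ : χ ≠ 0) (hirr : Irreducible P)
    (hfix : P.comp (X + C χ) = P) (hdeg : P.natDegree = p * s)
    (hdvd : P ∣ Fseq (Fintype.card F) F (p * s - 1)) :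
    ∃ α : K, (minpoly F α).natDegree = s ∧
      Algebra.trace F K α ≠ 0 ∧ Algebra.trace F K α ∈ AddSubgroup.closure {χ} ∧
      ((X : K[X]) ^ Fintype.card F - X - C α) ∣ Fseq (Fintype.card F) K (p * s - 1) ∧
      P.map (algebraMap F K) ∣
        ∏ i ∈ Finset.range s,
          ((X : K[X]) ^ Fintype.card F - X - C (α ^ Fintype.card F ^ (i + 1))) := by
  have hpL : ∀ t : L, p • t = 0 := fun t => by
    rw [nsmul_eq_mul, ← map_natCast (algebraMap F L), CharP.cast_eq_zero, map_zero, zero_mul]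
  obtain ⟨θ, hθ⟩ := IsAlgClosed.exists_aeval_eq_zero L P hirr.degree_pos.ne'
  have hper := frobeniusAlgHom_pow_eq_self_iff hirr hθ
  have hθχ : aeval (θ + algebraMap F L χ) P = 0 := by
    rw [← hθ]
    nth_rewrite 2 [← hfix]
    simp [aeval_comp]
  obtain ⟨j, hj⟩ := exists_frobeniusAlgHom_pow_eq hirr hθ hθχ
  have hjk := frobeniusAlgHom_pow_mul_apply hj (AlgHom.commutes _ _)
  have hsj : s ∣ j := by
    have h := (hper (j * p)).1 (by rw [hjk, hpL, add_zero])
    rw [hdeg, mul_comm] at h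
    exact Nat.dvd_of_mul_dvd_mul_right hp.pos h
  obtain ⟨u, rfl⟩ := hsj
  have hpu : ¬ p ∣ u := by
    rintro ⟨v, rfl⟩
    have h := (hper (s * (p * v))).2 (by rw [hdeg]; exact ⟨v, by ring⟩)
    rw [hj] at h
    exact hχ (by simpa using h)
  obtain ⟨k, -, hk⟩ := Nat.exists_mul_mod_eq_one_of_coprime
    ((Nat.Prime.coprime_iff_not_dvd hp).2 hpu).symm hp.one_lt
  set t : F := k • χ with ht
  have hθs : (φ ^ s) θ = θ + algebraMap F L t := by
    have hmod : s ≡ s * u * k [MOD p * s] := by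
      rw [mul_assoc, mul_comm p s]
      have h1 : 1 ≡ u * k [MOD p] := by
        rw [Nat.ModEq, hk, Nat.mod_eq_of_lt hp.one_lt]
      simpa using h1.mul_left' s
    rw [frobeniusAlgHom_pow_apply_of_modEq ((hper _).2 hdeg.dvd) hmod, hjk, ht, map_nsmul]
  have hps : ¬ p * s ∣ s := fun h => by
    have := Nat.le_of_dvd hs h
    have := hp.two_le
    nlinarith
  have ht0 : t ≠ 0 := fun h => by
    rw [h, map_zero, add_zero, hper, hdeg] at hθs
    exact hps hθs
  have hα : (φ ^ s) (φ θ - θ) = φ θ - θ := by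
    rw [map_sub, ← AlgHom.mul_apply, ← pow_succ, pow_succ', AlgHom.mul_apply, hθs, map_add,
      AlgHom.commutes]
    ring
  have hcard : Fintype.card K = Fintype.card F ^ s := by
    rw [← hK, Module.card_eq_pow_finrank (K := F) (V := K)]
  obtain ⟨α, hαθ⟩ := mem_range_algebraMap_of_pow_card_eq (F := K) (x := φ θ - θ) (by
    rw [hcard, ← frobeniusAlgHom_pow_apply, hα])
  have hint : IsIntegral F α := Algebra.IsIntegral.isIntegral α
  have hroot : aeval (φ θ - θ) (minpoly F α) = 0 := by
    rw [← hαθ, aeval_algebraMap_apply, minpoly.aeval, map_zero]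
  have hperα := frobeniusAlgHom_pow_eq_self_iff (minpoly.irreducible hint) hroot
  refine ⟨α, ?_, ?_⟩
  · refine Nat.dvd_antisymm ((hperα s).1 hα) ?_
    set r := (minpoly F α).natDegree
    have hr := (hperα r).2 dvd_rfl
    have hsum := frobeniusAlgHom_pow_eq_add_sum (F := F) θ r
    have h := frobeniusAlgHom_pow_mul_apply hsum (by
      rw [map_sum]
      refine Finset.sum_congr rfl fun i _ => ?_
      rw [← AlgHom.mul_apply, ← pow_add, add_comm, pow_add, AlgHom.mul_apply, hr]) p
    rw [hpL, add_zero, hper, hdeg, mul_comm] at h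
    exact Nat.dvd_of_mul_dvd_mul_right hp.pos h
  have htr : Algebra.trace F K α = t := by
    apply (algebraMap F L).injective
    have hsum := frobeniusAlgHom_pow_eq_add_sum (F := F) θ s
    rw [hθs, add_right_inj, ← hαθ] at hsum
    rw [hsum, IsScalarTower.algebraMap_apply F K L, FiniteField.algebraMap_trace_eq_sum_pow,
      map_sum, hK, Nat.card_eq_fintype_card]
    refine Finset.sum_congr rfl fun i _ => ?_
    rw [frobeniusAlgHom_pow_apply, map_pow]
  rw [htr]
  refine ⟨ht0, AddSubgroup.nsmul_mem _ (AddSubgroup.mem_closure_singleton_self χ) k, ?_, ?_⟩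
  · refine dvd_of_forall_aeval_eq_zero L (separable_X_pow_card_sub_X_sub_C F α) fun x hx => ?_
    simp only [map_sub, map_pow, aeval_X, aeval_C, hαθ, ← frobeniusAlgHom_apply_eq_pow] at hx
    obtain ⟨a, ha⟩ := mem_range_algebraMap_of_pow_card_eq (F := F) (x := x - θ) (by
      rw [← frobeniusAlgHom_apply_eq_pow, map_sub]
      linear_combination hx)
    rw [Fseq_map (F := F), aeval_map_algebraMap, ← add_sub_cancel θ x, ← ha,
      aeval_add_algebraMap_Fseq]
    exact (hirr.dvd_iff_aeval_eq_zero hθ).2 hdvd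
  · have hsep : P.Separable := PerfectField.separable_of_irreducible hirr
    refine dvd_of_forall_aeval_eq_zero L hsep.map fun x hx => ?_
    rw [aeval_map_algebraMap] at hx
    obtain ⟨j, rfl⟩ := exists_frobeniusAlgHom_pow_eq hirr hθ hx
    rw [map_prod]
    refine Finset.prod_eq_zero (i := (j + s - 1) % s) (Finset.mem_range.2 (Nat.mod_lt _ hs)) ?_
    have hmod : (j + s - 1) % s + 1 ≡ j [MOD s] := by
      have h1 : (j + s - 1) % s + 1 ≡ (j + s - 1) + 1 [MOD s] := (Nat.mod_modEq _ _).add_right 1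
      rw [Nat.sub_add_cancel (by omega)] at h1
      exact h1.trans (by simp [Nat.ModEq])
    simp only [map_sub, map_pow, aeval_X, aeval_C, hαθ]
    rw [← map_pow, ← frobeniusAlgHom_apply_eq_pow, ← frobeniusAlgHom_pow_apply,
      frobeniusAlgHom_pow_apply_of_modEq hα hmod, map_sub, sub_self]

theorem fixed_of_exists_natDegree_minpoly_eq (hp : p.Prime) (hs : 0 < s)
    (hK : Module.finrank F K = s) (hmon : P.Monic) (hirr : Irreducible P)
    {α : K} (hdeg : (minpoly F α).natDegree = s)
    (htr0 : Algebra.trace F K α ≠ 0) (htr : Algebra.trace F K α ∈ AddSubgroup.closure {χ})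
    (hdvd : ((X : K[X]) ^ Fintype.card F - X - C α) ∣ Fseq (Fintype.card F) K (p * s - 1))
    (hP : P.map (algebraMap F K) ∣
      ∏ i ∈ Finset.range s,
        ((X : K[X]) ^ Fintype.card F - X - C (α ^ Fintype.card F ^ (i + 1)))) :
    (∀ a ∈ AddSubgroup.closure {χ}, P.comp (X + C a) = P) ∧ P.natDegree = p * s ∧
      P ∣ Fseq (Fintype.card F) F (p * s - 1) := by
  have hpL : ∀ t : L, p • t = 0 := fun t => by
    rw [nsmul_eq_mul, ← map_natCast (algebraMap F L), CharP.cast_eq_zero, map_zero, zero_mul]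
  obtain ⟨θ, hθ⟩ := IsAlgClosed.exists_aeval_eq_zero L P hirr.degree_pos.ne'
  have hper := frobeniusAlgHom_pow_eq_self_iff hirr hθ
  set β : L := algebraMap K L α with hβ
  have hint : IsIntegral F α := Algebra.IsIntegral.isIntegral α
  have hroot : aeval β (minpoly F α) = 0 := by
    rw [hβ, aeval_algebraMap_apply, minpoly.aeval, map_zero]
  have hperβ := frobeniusAlgHom_pow_eq_self_iff (minpoly.irreducible hint) hroot
  rw [hdeg] at hperβ
  have hβs := (hperβ s).2 dvd_rfl
  obtain ⟨i, hi, hθi⟩ : ∃ i < s, φ θ - θ = (φ ^ (i + 1)) β := by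
    have h := aeval_eq_zero_of_dvd_aeval_eq_zero hP ((aeval_map_algebraMap K θ P).trans hθ)
    rw [map_prod, Finset.prod_eq_zero_iff] at h
    obtain ⟨i, hi, h⟩ := h
    refine ⟨i, Finset.mem_range.1 hi, ?_⟩
    simp only [map_sub, map_pow, aeval_X, aeval_C] at h
    rw [frobeniusAlgHom_apply_eq_pow, frobeniusAlgHom_pow_apply]
    exact sub_eq_zero.1 h
  set t := Algebra.trace F K α
  have hsum : ∑ i ∈ Finset.range s, (φ ^ i) β = algebraMap F L t := by
    rw [IsScalarTower.algebraMap_apply F K L, FiniteField.algebraMap_trace_eq_sum_pow,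
      map_sum, hK, Nat.card_eq_fintype_card]
    refine Finset.sum_congr rfl fun i _ => ?_
    rw [frobeniusAlgHom_pow_apply, map_pow]
  have hcomm : ∀ (a b : ℕ) (x : L), (φ ^ a) ((φ ^ b) x) = (φ ^ b) ((φ ^ a) x) := fun a b x => by
    rw [← AlgHom.mul_apply, ← AlgHom.mul_apply, ← pow_add, ← pow_add, add_comm]
  have hθs : (φ ^ s) θ = θ + algebraMap F L t := by
    rw [frobeniusAlgHom_pow_eq_add_sum, hθi, ← AlgHom.commutes (φ ^ (i + 1)) t, ← hsum, map_sum]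
    congr 1
    exact Finset.sum_congr rfl fun _ _ => hcomm _ _ _
  have hsk := frobeniusAlgHom_pow_mul_apply hθs (AlgHom.commutes _ _)
  have hinj : ∀ n : ℕ, Function.Injective (φ ^ n : L →ₐ[F] L) := fun n => (φ ^ n).injective
  refine ⟨fun a ha => ?_, ?_, ?_⟩
  · obtain ⟨k, hk⟩ : ∃ k : ℕ, k • t = a := by
      have := Fact.mk hp
      obtain ⟨n, hn⟩ := AddSubgroup.mem_closure_singleton.1 htr
      obtain ⟨n', hn'⟩ := AddSubgroup.mem_closure_singleton.1 ha
      have hn0 : (n : ZMod p) ≠ 0 := fun h => by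
        rw [ZMod.intCast_zmod_eq_zero_iff_dvd, ← CharP.intCast_eq_zero_iff F p] at h
        rw [zsmul_eq_mul, h, zero_mul] at hn
        exact htr0 hn.symm
      refine ⟨((n' : ZMod p) / n).val, ?_⟩
      have h : (((((n' : ZMod p) / n).val : ℤ) * n : ℤ) : ZMod p) = (n' : ℤ) := by
        push_cast
        rw [ZMod.natCast_zmod_val, div_mul_cancel₀ _ hn0]
      rw [ZMod.intCast_eq_intCast_iff, ← CharP.intCast_eq_intCast F] at h
      rw [← hn, ← hn', nsmul_eq_mul, zsmul_eq_mul, zsmul_eq_mul, ← mul_assoc, ← h]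
      push_cast
      rfl
    refine comp_X_add_C_eq_self hirr hmon hθ ?_
    rw [← hk, map_nsmul, ← hsk, aeval_frobeniusAlgHom_pow, hθ, map_zero]
  · have h1 : P.natDegree ∣ s * p := (hper _).1 (by rw [hsk, hpL, add_zero])
    have h2 : s ∣ P.natDegree := by
      refine (hperβ _).1 (hinj (i + 1) ?_)
      rw [hcomm, ← hθi, map_sub, (hper _).2 dvd_rfl]
      congr 1
      have h := hcomm P.natDegree 1 θ
      rwa [pow_one, (hper _).2 dvd_rfl] at h
    obtain ⟨k, hk⟩ := h2
    rw [hk] at h1 ⊢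
    rcases (Nat.dvd_prime hp).1 (Nat.dvd_of_mul_dvd_mul_left hs h1) with rfl | rfl
    · refine absurd ?_ htr0
      have h := (hper s).2 (by rw [hk, mul_one])
      rw [hθs] at h
      simpa using h
    · exact mul_comm _ _
  · rw [← hirr.dvd_iff_aeval_eq_zero hθ]
    apply hinj (s - (i + 1))
    rw [map_zero, ← aeval_frobeniusAlgHom_pow, ← aeval_map_algebraMap K, ← Fseq_map]
    refine aeval_eq_zero_of_dvd_aeval_eq_zero hdvd ?_
    simp only [map_sub, map_pow, aeval_X, aeval_C]
    rw [← map_pow, ← frobeniusAlgHom_apply_eq_pow, ← map_sub, hθi, ← AlgHom.mul_apply, ← pow_add,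
      Nat.sub_add_cancel hi, hβs, sub_self]

end Wieferich

/-- Let `q = p^m ≥ 3`, `s ≥ 1`, `χ ∈ F_q` nonzero and `G = χ·F_p`.
A monic irreducible polynomial `P ∈ F_q[T]` is a `G`-fixed c-Wieferich prime of degree
`p·s` if and only if there exists `α ∈ F_{q^s}` of degree `s` over `F_q` such that
`Tr_{F_{q^s}/F_q}(α)` is a nonzero element of `G`,
`F_{ps−1} ≡ 0 (mod T^q − T − α)` in `F_{q^s}[T]`, and `P` divides
`∏_{i=1}^{s} (T^q − T − α^{q^i})`. -/
theorem stmt6 (p m s : ℕ) (hp : p.Prime) (hq3 : 3 ≤ p ^ m) (hs : 0 < s)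
    (F K : Type*) [Field F] [Fintype F] [Field K] [Fintype K] [Algebra F K]
    (hF : Fintype.card F = p ^ m) (hK : Module.finrank F K = s)
    (χ : F) (hχ : χ ≠ 0)
    (P : Polynomial F) (hmon : P.Monic) (hirr : Irreducible P) :
    ((∀ a ∈ AddSubgroup.closure {χ}, P.comp (X + C a) = P) ∧ P.natDegree = p * s ∧
        P ∣ Fseq (p ^ m) F (p * s - 1)) ↔
      ∃ α : K, (minpoly F α).natDegree = s ∧
        Algebra.trace F K α ≠ 0 ∧ Algebra.trace F K α ∈ AddSubgroup.closure {χ} ∧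
        ((X : Polynomial K) ^ p ^ m - X - C α) ∣ Fseq (p ^ m) K (p * s - 1) ∧
        P.map (algebraMap F K) ∣
          ∏ i ∈ Finset.range s,
            ((X : Polynomial K) ^ p ^ m - X - C (α ^ (p ^ m) ^ (i + 1))) := by
  have := Fact.mk hp
  have : CharP F p := charP_of_card_eq_prime_pow hF
  rw [← hF]
  constructor
  · rintro ⟨hfix, hdeg, hdvd⟩
    exact exists_natDegree_minpoly_eq_of_fixed hp hs hK hχ hirr
      (hfix χ (AddSubgroup.mem_closure_singleton_self χ)) hdeg hdvd
  · rintro ⟨α, hdeg, htr0, htr, hdvd, hP⟩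
    exact fixed_of_exists_natDegree_minpoly_eq hp hs hK hmon hirr hdeg htr0 htr hdvd hP
end

section
/- Let s ≥ 1 and let α, β ∈ F_{q^s} both have degree s over F_q. Set R_{q,s,α} = ∏_{i=1}^{s} (T^q − T − α^{q^i}) and R_{q,s,β} = ∏_{i=1}^{s} (T^q − T − β^{q^i}). If R_{q,s,α} and R_{q,s,β} have a common root (in an algebraic closure of F_q), then R_{q,s,α} = R_{q,s,β}; moreover, R_{q,s,α} = R_{q,s,β} if and only if α = β^{q^i} for some i with 1 ≤ i ≤ s. -/
open Polynomial

theorem Function.Periodic.prod_range_add {M : Type*} [CommMonoid M] {f : ℕ → M} {s : ℕ}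
    (hf : Function.Periodic f s) (k : ℕ) :
    ∏ i ∈ Finset.range s, f (i + k) = ∏ i ∈ Finset.range s, f i := by
  induction k with
  | zero => rfl
  | succ k ih =>
    rw [← ih]
    cases s with
    | zero => rfl
    | succ s =>
      rw [Finset.prod_range_succ (fun i => f (i + (k + 1))),
        Finset.prod_range_succ' (fun i => f (i + k))]
      have h₂ : f (s + (k + 1)) = f (0 + k) := by
        rw [zero_add, ← hf k]
        congr 1
        omega
      rw [h₂]
      congr 1
      refine Finset.prod_congr rfl fun i _ => ?_
      congr 1
      omega

theorem periodic_pow_pow {M : Type*} [Monoid M] {b : M} {Q s : ℕ} (hb : b ^ Q ^ s = b) :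
    Function.Periodic (fun i => b ^ Q ^ i) s := by
  intro i
  simp only
  rw [pow_add, mul_comm, pow_mul, hb]

theorem exists_eq_pow_pow_of_pow_pow_eq {M : Type*} [Monoid M] {a b : M} {Q s i j : ℕ}
    (hs : 0 < s) (ha : a ^ Q ^ s = a) (hb : b ^ Q ^ s = b) (hi : i < s)
    (h : a ^ Q ^ (i + 1) = b ^ Q ^ (j + 1)) : ∃ k, 1 ≤ k ∧ k ≤ s ∧ a = b ^ Q ^ k := by
  obtain ⟨e, he⟩ : ∃ e, i + 1 + e = s := ⟨s - (i + 1), by omega⟩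
  have h₁ : a = b ^ Q ^ (j + e + 1) := by
    calc a = a ^ Q ^ (i + 1 + e) := by rw [he, ha]
      _ = b ^ Q ^ (j + 1 + e) := by rw [pow_add, pow_mul, h, ← pow_mul, ← pow_add]
      _ = b ^ Q ^ (j + e + 1) := by rw [add_right_comm]
  refine ⟨(j + e) % s + 1, by omega, Nat.mod_lt _ hs, h₁.trans ?_⟩
  have h₂ := (periodic_pow_pow hb).map_mod_nat (j + e)
  rw [pow_succ, pow_mul, ← h₂, ← pow_mul, ← pow_succ]

theorem prod_eq_of_eq_pow_pow {K : Type*} [Field K] {b : K} {Q s : ℕ} (hb : b ^ Q ^ s = b)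
    (k : ℕ) :
    ∏ i ∈ Finset.range s, ((X : K[X]) ^ Q - X - C ((b ^ Q ^ k) ^ Q ^ (i + 1))) =
      ∏ i ∈ Finset.range s, ((X : K[X]) ^ Q - X - C (b ^ Q ^ (i + 1))) := by
  have hp : Function.Periodic (fun i => (X : K[X]) ^ Q - X - C (b ^ Q ^ (i + 1))) s := by
    intro i
    have h := periodic_pow_pow hb (i + 1)
    simp only at h ⊢
    rw [add_right_comm, h]
  rw [← hp.prod_range_add k]
  refine Finset.prod_congr rfl fun i _ => ?_
  rw [← pow_mul, ← pow_add, add_right_comm, add_comm k, add_right_comm]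

theorem exists_aeval_pow_sub_X_sub_C_eq_zero {K : Type*} [Field K] {Q : ℕ} (hQ : 1 < Q) (a : K) :
    ∃ x : AlgebraicClosure K, aeval x ((X : K[X]) ^ Q - X - C a) = 0 := by
  refine IsAlgClosed.exists_aeval_eq_zero _ _ ?_
  have h : ((X : K[X]) ^ Q - X - C a).degree = (Q : WithBot ℕ) := by
    rw [sub_sub, degree_sub_eq_left_of_degree_lt, degree_X_pow]
    rw [degree_X_pow, degree_X_add_C]
    exact_mod_cast hQ
  rw [h]
  exact_mod_cast (by omega : Q ≠ 0)

/-- Let `s ≥ 1` and let `α, β ∈ F_{q^s}` both have degree `s` over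
`F_q`.  Set `R_{q,s,α} = ∏_{i=1}^{s} (T^q − T − α^{q^i})` and similarly for `β`.
If `R_{q,s,α}` and `R_{q,s,β}` have a common root in an algebraic closure, then
`R_{q,s,α} = R_{q,s,β}`; moreover `R_{q,s,α} = R_{q,s,β}` if and only if
`α = β^{q^i}` for some `1 ≤ i ≤ s`. -/
theorem stmt7 (p m s : ℕ) (hp : p.Prime) (hm : 0 < m) (hs : 0 < s)
    (F K : Type*) [Field F] [Fintype F] [Field K] [Fintype K] [Algebra F K]
    (hF : Fintype.card F = p ^ m) (hK : Module.finrank F K = s)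
    (α β : K) (hα : (minpoly F α).natDegree = s) (hβ : (minpoly F β).natDegree = s) :
    ((∃ x : AlgebraicClosure K,
        Polynomial.aeval x (∏ i ∈ Finset.range s,
          ((X : Polynomial K) ^ p ^ m - X - C (α ^ (p ^ m) ^ (i + 1)))) = 0 ∧
        Polynomial.aeval x (∏ i ∈ Finset.range s,
          ((X : Polynomial K) ^ p ^ m - X - C (β ^ (p ^ m) ^ (i + 1)))) = 0) →
      (∏ i ∈ Finset.range s,
          ((X : Polynomial K) ^ p ^ m - X - C (α ^ (p ^ m) ^ (i + 1)))) =
        ∏ i ∈ Finset.range s,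
          ((X : Polynomial K) ^ p ^ m - X - C (β ^ (p ^ m) ^ (i + 1)))) ∧
    ((∏ i ∈ Finset.range s,
          ((X : Polynomial K) ^ p ^ m - X - C (α ^ (p ^ m) ^ (i + 1)))) =
        (∏ i ∈ Finset.range s,
          ((X : Polynomial K) ^ p ^ m - X - C (β ^ (p ^ m) ^ (i + 1)))) ↔
      ∃ i, 1 ≤ i ∧ i ≤ s ∧ α = β ^ (p ^ m) ^ i) := by
  have hQ : 1 < p ^ m := Nat.one_lt_pow hm.ne' hp.one_lt
  have hfix (a : K) : a ^ (p ^ m) ^ s = a := by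
    rw [← hF, ← hK, ← Module.card_eq_pow_finrank, FiniteField.pow_card]
  generalize p ^ m = Q at *
  have hroot : (∃ x : AlgebraicClosure K,
        aeval x (∏ i ∈ Finset.range s, ((X : K[X]) ^ Q - X - C (α ^ Q ^ (i + 1)))) = 0 ∧
        aeval x (∏ i ∈ Finset.range s, ((X : K[X]) ^ Q - X - C (β ^ Q ^ (i + 1)))) = 0) →
      ∃ i, 1 ≤ i ∧ i ≤ s ∧ α = β ^ Q ^ i := by
    rintro ⟨x, hxα, hxβ⟩
    rw [map_prod, Finset.prod_eq_zero_iff] at hxα hxβ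
    obtain ⟨i, hi, hxi⟩ := hxα
    obtain ⟨j, -, hxj⟩ := hxβ
    refine exists_eq_pow_pow_of_pow_pow_eq hs (hfix α) (hfix β) (Finset.mem_range.mp hi) (j := j) ?_
    rw [map_sub, aeval_C, sub_eq_zero] at hxi hxj
    exact (algebraMap K (AlgebraicClosure K)).injective (hxi.symm.trans hxj)
  refine ⟨fun h => ?_, fun h => ?_, ?_⟩
  · obtain ⟨k, -, -, rfl⟩ := hroot h
    exact prod_eq_of_eq_pow_pow (hfix β) k
  · obtain ⟨x, hx⟩ := exists_aeval_pow_sub_X_sub_C_eq_zero hQ (α ^ Q ^ (0 + 1))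
    have hx' : aeval x (∏ i ∈ Finset.range s,
        ((X : K[X]) ^ Q - X - C (α ^ Q ^ (i + 1)))) = 0 := by
      rw [map_prod]
      exact Finset.prod_eq_zero (Finset.mem_range.mpr hs) hx
    exact hroot ⟨x, hx', h ▸ hx'⟩
  · rintro ⟨k, -, -, rfl⟩
    exact prod_eq_of_eq_pow_pow (hfix β) k
end

section
/- Fix s ≥ 1 and an element α ∈ F_{q^s} of degree s over F_q. Fix k ≥ 1 and put r = 1 + sk. Then for any n ≥ 1, F_{q,n} ≡ 0 (mod T^q − T − α) in F_{q^s}[T] if and only if F_{q^r,n} ≡ 0 (mod T^{q^r} − T − α) in F_{q^s}[T]. -/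
open Polynomial

/-- The residue of `Fseq Q K i` modulo `X ^ Q - X - C α`, which is a constant. -/
noncomputable def FseqResidue {K : Type*} [Field K] (Q : ℕ) (α : K) : ℕ → K
  | 0 => 1
  | i + 1 => (-1) ^ (i + 1) + (∑ j ∈ Finset.range (i + 1), α ^ Q ^ j) * FseqResidue Q α i

theorem FseqResidue_congr {K : Type*} [Field K] {Q R : ℕ} {α : K}
    (h : ∀ j, α ^ Q ^ j = α ^ R ^ j) (n : ℕ) : FseqResidue Q α n = FseqResidue R α n := by
  induction n with
  | zero => rfl
  | succ n ih => simp only [FseqResidue, ih, h]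

theorem artinSchreier_dvd_X_pow_sub {K : Type*} [Field K] (p : ℕ) [Fact p.Prime] [CharP K p]
    {Q e : ℕ} (hQ : Q = p ^ e) (α : K) (i : ℕ) :
    ((X : K[X]) ^ Q - X - C α) ∣ X ^ Q ^ i - X - C (∑ j ∈ Finset.range i, α ^ Q ^ j) := by
  induction i with
  | zero => simp
  | succ i ih =>
    have hpow : ((X : K[X]) ^ Q - X - C α) ^ Q ^ i = X ^ Q ^ (i + 1) - X ^ Q ^ i - C (α ^ Q ^ i) := by
      have hi : Q ^ i = p ^ (e * i) := by rw [hQ, pow_mul]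
      rw [hi, sub_pow_char_pow, sub_pow_char_pow, ← hi, ← pow_mul, ← pow_succ', C_pow]
    have hQ0 : Q ^ i ≠ 0 := by
      rw [hQ]
      exact pow_ne_zero _ (pow_ne_zero _ (Fact.out : p.Prime).ne_zero)
    have hdvd := dvd_add (dvd_pow_self ((X : K[X]) ^ Q - X - C α) hQ0) ih
    rw [hpow] at hdvd
    convert hdvd using 1
    rw [Finset.sum_range_succ, C_add]
    ring

theorem artinSchreier_dvd_Fseq_sub {K : Type*} [Field K] (p : ℕ) [Fact p.Prime] [CharP K p]
    {Q e : ℕ} (hQ : Q = p ^ e) (α : K) (n : ℕ) :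
    ((X : K[X]) ^ Q - X - C α) ∣ Fseq Q K n - C (FseqResidue Q α n) := by
  induction n with
  | zero => simp [Fseq, FseqResidue]
  | succ n ih =>
    have hdvd := dvd_add
      ((artinSchreier_dvd_X_pow_sub p hQ α (n + 1)).mul_right (Fseq Q K n))
      (ih.mul_left (C (∑ j ∈ Finset.range (n + 1), α ^ Q ^ j)))
    convert hdvd using 1
    simp only [Fseq, FseqResidue, C_add, C_mul, C_pow, C_neg, C_1]
    ring

theorem artinSchreier_dvd_C_iff {K : Type*} [Field K] {Q : ℕ} (hQ : 1 < Q) (α c : K) :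
    ((X : K[X]) ^ Q - X - C α) ∣ C c ↔ c = 0 := by
  refine ⟨fun h => ?_, fun h => by simp [h]⟩
  by_contra hc
  have hdeg : ((X : K[X]) ^ Q - X - C α).natDegree = Q := by
    rw [natDegree_sub_C, natDegree_sub_eq_left_of_natDegree_lt] <;> simp [hQ]
  have hle := natDegree_le_of_dvd h (C_ne_zero.mpr hc)
  rw [hdeg, natDegree_C] at hle
  omega

theorem artinSchreier_dvd_Fseq_iff {K : Type*} [Field K] (p : ℕ) [Fact p.Prime] [CharP K p]
    {Q e : ℕ} (hQ : Q = p ^ e) (hQ1 : 1 < Q) {α : K} {n : ℕ} :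
    ((X : K[X]) ^ Q - X - C α) ∣ Fseq Q K n ↔ FseqResidue Q α n = 0 := by
  rw [← artinSchreier_dvd_C_iff hQ1 α, dvd_iff_dvd_of_dvd_sub (artinSchreier_dvd_Fseq_sub p hQ α n)]

/-- Fix `s ≥ 1` and `α ∈ F_{q^s}` of degree `s` over `F_q`.
Fix `k ≥ 1` and put `r = 1 + sk`.  Then for any `n ≥ 1`,
`F_{q,n} ≡ 0 (mod T^q − T − α)` if and only if `F_{q^r,n} ≡ 0 (mod T^{q^r} − T − α)`
(both congruences taking place in `F_{q^s}[T]`). -/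
theorem stmt11 (q s k : ℕ) (hs : 1 ≤ s) (hk : 1 ≤ k)
    (F K : Type*) [Field F] [Fintype F] [Field K] [Fintype K] [Algebra F K]
    (hF : Fintype.card F = q) (hK : Module.finrank F K = s)
    (α : K) (hα : (minpoly F α).natDegree = s) (n : ℕ) (hn : 1 ≤ n) :
    ((X : Polynomial K) ^ q - X - C α) ∣ Fseq q K n ↔
      ((X : Polynomial K) ^ q ^ (1 + s * k) - X - C α) ∣ Fseq (q ^ (1 + s * k)) K n := by
  obtain ⟨p, hp⟩ := CharP.exists F
  obtain ⟨m, hpp, hm⟩ := FiniteField.card F p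
  have : Fact p.Prime := ⟨hpp⟩
  have : CharP K p := charP_of_injective_algebraMap (algebraMap F K).injective p
  have hqm : q = p ^ (m : ℕ) := hF.symm.trans hm
  have hQm : q ^ (1 + s * k) = p ^ ((m : ℕ) * (1 + s * k)) := by rw [hqm, pow_mul]
  have hq : 1 < q := hF ▸ Fintype.one_lt_card
  have hQ : 1 < q ^ (1 + s * k) := Nat.one_lt_pow (by omega) hq
  have hcard : Fintype.card K = q ^ s := by rw [← hF, ← hK, Module.card_eq_pow_finrank (K := F)]
  have htrace (j : ℕ) : α ^ (q ^ (1 + s * k)) ^ j = α ^ q ^ j := by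
    have h : (q ^ (1 + s * k)) ^ j = (q ^ s) ^ (k * j) * q ^ j := by ring
    rw [h, pow_mul, ← hcard, FiniteField.pow_card_pow]
  rw [artinSchreier_dvd_Fseq_iff p hqm hq, artinSchreier_dvd_Fseq_iff p hQm hQ,
    FseqResidue_congr htrace]
end

section
/- Let G be an additive subgroup of F_q of order p. If there exists a G-fixed c-Wieferich prime in F_q[T] of degree p, then every G-fixed monic irreducible polynomial in F_q[T] of degree p is a c-Wieferich prime in F_{q^r}[T] for at least one r ∈ {1, 2, …, p−1}, i.e., it divides F_{q^r, p−1} for some such r. -/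
open Polynomial

/-- The recursion satisfied by the values of `Fseq q` at a point `x` with
`x ^ q ^ i - x = i * y` for all `i`. -/
def wieferichValue {F : Type*} [Field F] (y : F) : ℕ → F
  | 0 => 1
  | i + 1 => (-1) ^ (i + 1) + ((i + 1 : ℕ) : F) * y * wieferichValue y i

theorem map_Fseq {F K : Type*} [Field F] [Field K] (f : F →+* K) (q n : ℕ) :
    (Fseq q F n).map f = Fseq q K n := by
  induction n with
  | zero => simp [Fseq]
  | succ n ih => simp [Fseq, ih]

theorem aeval_Fseq {F L : Type*} [Field F] [Field L] [Algebra F L] (q : ℕ) (x : L) (y : F)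
    (h : ∀ i : ℕ, x ^ q ^ i = x + i • algebraMap F L y) (n : ℕ) :
    aeval x (Fseq q F n) = algebraMap F L (wieferichValue y n) := by
  induction n with
  | zero => simp [Fseq, wieferichValue]
  | succ n ih =>
    simp only [Fseq, wieferichValue, map_add, map_mul, map_sub, map_pow, map_neg, map_one,
      aeval_X, ih, h, map_natCast, nsmul_eq_mul]
    ring

theorem pow_pow_card_eq_add_nsmul {F L : Type*} [Field F] [Fintype F] [Field L] [Algebra F L]
    {x : L} {g : F} (h : x ^ Fintype.card F = x + algebraMap F L g) (i : ℕ) :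
    x ^ Fintype.card F ^ i = x + i • algebraMap F L g := by
  induction i with
  | zero => simp
  | succ i ih =>
    have key : FiniteField.frobeniusAlgHom F L (x + i • algebraMap F L g)
        = x + (i + 1) • algebraMap F L g := by
      rw [map_add, map_nsmul, AlgHom.commutes, FiniteField.frobeniusAlgHom_apply, h, succ_nsmul]
      ring
    rw [pow_succ, pow_mul, ih, ← key, FiniteField.frobeniusAlgHom_apply]

/-- The Frobenius translates a root of a `G`-fixed irreducible polynomial of degree `#G` by an
element of `G`. -/
theorem exists_mem_root_pow_card {F : Type*} [Field F] [Fintype F] (G : AddSubgroup F)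
    {Q : F[X]} [Fact (Irreducible Q)] (hdeg : Q.natDegree = Nat.card G)
    (hQ : ∀ a ∈ G, Q.comp (X + C a) = Q) :
    ∃ g ∈ G, AdjoinRoot.root Q ^ Fintype.card F
      = AdjoinRoot.root Q + algebraMap F (AdjoinRoot Q) g := by
  classical
  have hirr : Irreducible Q := Fact.out
  set α := AdjoinRoot.root Q
  have hα : aeval α Q = 0 := AdjoinRoot.aeval_eq Q ▸ AdjoinRoot.mk_self
  have hα' : aeval (α ^ Fintype.card F) Q = 0 := by
    rw [← FiniteField.frobeniusAlgHom_apply F (AdjoinRoot Q) α, aeval_algHom_apply, hα, map_zero]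
  have hroot (a : F) (ha : a ∈ G) : aeval (α + algebraMap F (AdjoinRoot Q) a) Q = 0 := by
    have h := congrArg (aeval α) (hQ a ha)
    simpa [aeval_comp, hα] using h
  set S : Finset (AdjoinRoot Q) :=
    Finset.univ.image fun a : G ↦ α + algebraMap F (AdjoinRoot Q) a
  have hinj : Function.Injective fun a : G ↦ α + algebraMap F (AdjoinRoot Q) a := fun a b hab ↦
    Subtype.ext ((algebraMap F (AdjoinRoot Q)).injective (add_left_cancel hab))
  have hScard : S.card = Nat.card G := by
    rw [Finset.card_image_of_injective _ hinj, Finset.card_univ, Nat.card_eq_fintype_card]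
  have hsub : S ⊆ (Q.aroots (AdjoinRoot Q)).toFinset := by
    intro x hx
    obtain ⟨a, -, rfl⟩ := Finset.mem_image.1 hx
    exact Multiset.mem_toFinset.2 (mem_aroots.2 ⟨hirr.ne_zero, hroot a a.2⟩)
  have hle : (Q.aroots (AdjoinRoot Q)).toFinset.card ≤ S.card := by
    rw [hScard, ← hdeg]
    exact (Multiset.toFinset_card_le _).trans ((card_roots' _).trans natDegree_map_le)
  have hmem : α ^ Fintype.card F ∈ S := by
    rw [Finset.eq_of_subset_of_card_le hsub hle]
    exact Multiset.mem_toFinset.2 (mem_aroots.2 ⟨hirr.ne_zero, hα'⟩)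
  obtain ⟨a, -, ha⟩ := Finset.mem_image.1 hmem
  exact ⟨a, a.2, ha.symm⟩

theorem root_pow_card_ne {F : Type*} [Field F] [Fintype F] {Q : F[X]} [Fact (Irreducible Q)]
    (hdeg : 1 < Q.natDegree) : AdjoinRoot.root Q ^ Fintype.card F ≠ AdjoinRoot.root Q := by
  intro h
  have hirr : Irreducible Q := Fact.out
  have hdvd : Q ∣ X ^ Fintype.card F - X := by
    rw [← AdjoinRoot.mk_eq_zero]
    simp [h]
  have hsplits : (X ^ Fintype.card F - X : F[X]).Splits := by
    rw [splits_iff_card_roots, FiniteField.roots_X_pow_card_sub_X, ← Finset.card_def,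
      Finset.card_univ, FiniteField.X_pow_card_sub_X_natDegree_eq F Fintype.one_lt_card]
  have hQ := hsplits.of_dvd (FiniteField.X_pow_card_sub_X_ne_zero F Fintype.one_lt_card) hdvd
  exact hdeg.ne' (natDegree_eq_of_degree_eq_some (hQ.degree_eq_one_of_irreducible hirr))

theorem exists_mem_ne_zero_root_pow_card {F : Type*} [Field F] [Fintype F] (G : AddSubgroup F)
    {Q : F[X]} [Fact (Irreducible Q)] (hdeg : Q.natDegree = Nat.card G) (hG : 1 < Nat.card G)
    (hQ : ∀ a ∈ G, Q.comp (X + C a) = Q) :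
    ∃ g ∈ G, g ≠ 0 ∧ ∀ i : ℕ, AdjoinRoot.root Q ^ Fintype.card F ^ i
      = AdjoinRoot.root Q + i • algebraMap F (AdjoinRoot Q) g := by
  obtain ⟨g, hg, h⟩ := exists_mem_root_pow_card G hdeg hQ
  refine ⟨g, hg, ?_, pow_pow_card_eq_add_nsmul h⟩
  rintro rfl
  exact root_pow_card_ne (hdeg ▸ hG) (by simpa using h)

theorem dvd_Fseq_iff {F : Type*} [Field F] {Q : F[X]} [Fact (Irreducible Q)] {q : ℕ} {y : F}
    (h : ∀ i : ℕ, AdjoinRoot.root Q ^ q ^ i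
      = AdjoinRoot.root Q + i • algebraMap F (AdjoinRoot Q) y) (n : ℕ) :
    Q ∣ Fseq q F n ↔ wieferichValue y n = 0 := by
  rw [← AdjoinRoot.mk_eq_zero, ← AdjoinRoot.aeval_eq, aeval_Fseq q _ y h, map_eq_zero]

/-- Let `G` be an additive subgroup of `F_q` of order `p`.  If there
exists a `G`-fixed c-Wieferich prime in `F_q[T]` of degree `p`, then every `G`-fixed
monic irreducible polynomial in `F_q[T]` of degree `p` is a c-Wieferich prime in
`F_{q^r}[T]` for at least one `r ∈ {1, …, p−1}`, i.e. it divides `F_{q^r, p−1}` for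
some such `r`. -/
theorem stmt15 (p m : ℕ) (hp : p.Prime) (hm : 0 < m)
    (F : Type) [Field F] [Fintype F] (hF : Fintype.card F = p ^ m)
    (G : AddSubgroup F) (hG : Nat.card G = p)
    (hexists : ∃ P : Polynomial F, P.Monic ∧ Irreducible P ∧ P.natDegree = p ∧
      (∀ a ∈ G, P.comp (X + C a) = P) ∧ P ∣ Fseq (p ^ m) F (p - 1)) :
    ∀ Q : Polynomial F, Q.Monic → Irreducible Q → Q.natDegree = p →
      (∀ a ∈ G, Q.comp (X + C a) = Q) →
      ∃ r : ℕ, 1 ≤ r ∧ r ≤ p - 1 ∧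
        ∀ (K : Type) [Field K] [Fintype K] [Algebra F K],
          Module.finrank F K = r →
          Q.map (algebraMap F K) ∣ Fseq ((p ^ m) ^ r) K (p - 1) := by
  obtain ⟨P, -, hPirr, hPdeg, hPG, hPdvd⟩ := hexists
  intro Q _ hQirr hQdeg hQG
  have : Fact p.Prime := ⟨hp⟩
  have : Fact (Irreducible P) := ⟨hPirr⟩
  have : Fact (Irreducible Q) := ⟨hQirr⟩
  have hG1 : 1 < Nat.card G := hG ▸ hp.one_lt
  obtain ⟨a, haG, ha0, ha⟩ :=
    exists_mem_ne_zero_root_pow_card G (hPdeg.trans hG.symm) hG1 hPG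
  obtain ⟨b, hbG, hb0, hb⟩ :=
    exists_mem_ne_zero_root_pow_card G (hQdeg.trans hG.symm) hG1 hQG
  rw [hF] at ha hb
  rw [dvd_Fseq_iff ha] at hPdvd
  have hb0' : (⟨b, hbG⟩ : G) ≠ 0 := fun h ↦ hb0 (congrArg Subtype.val h)
  obtain ⟨n, hn⟩ := mem_multiples_of_prime_card (g' := (⟨a, haG⟩ : G)) hG hb0'
  have hpb : p • (⟨b, hbG⟩ : G) = 0 := hG ▸ card_nsmul_eq_zero'
  have hr : (n % p) • b = a := by
    have h : (n % p) • (⟨b, hbG⟩ : G) = ⟨a, haG⟩ := by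
      rw [← hn]
      conv_rhs => rw [← Nat.mod_add_div n p]
      simp [add_nsmul, mul_nsmul, hpb]
    exact congrArg Subtype.val h
  have hr0 : n % p ≠ 0 := fun h ↦ ha0 (by rw [← hr, h, zero_nsmul])
  have hrp : n % p < p := Nat.mod_lt _ hp.pos
  refine ⟨n % p, by omega, by omega, fun K _ _ _ _ ↦ ?_⟩
  rw [← map_Fseq (algebraMap F K)]
  refine Polynomial.map_dvd _ ((dvd_Fseq_iff (y := a) (fun i ↦ ?_) _).2 hPdvd)
  rw [← pow_mul, hb, ← hr, map_nsmul, mul_comm, mul_nsmul']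
end

section
/- Let s ≥ 1 and k ≥ 1 be integers, set r = 1 + sk, and let w, α ∈ F_{q^s}. Then the polynomial T^q − T − w divides T^{q^r} − T − α in F_{q^s}[T] if and only if α = w + k·Tr_{F_{q^s}/F_q}(w), where the integer k acts via the natural map to the prime field F_p. -/
open Polynomial

/-- Modulo `T ^ q - T - w`, the `n`-fold Frobenius translates `T` by `∑ i < n, w ^ q ^ i`. -/
theorem artinSchreier_dvd_X_pow_card_pow_sub_X_sub_C (F : Type*) {K : Type*} [Field F] [Fintype F]
    [Field K] [Algebra F K] (w : K) (n : ℕ) :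
    ((X : K[X]) ^ Fintype.card F - X - C w) ∣
      X ^ Fintype.card F ^ n - X - C (∑ i ∈ Finset.range n, w ^ Fintype.card F ^ i) := by
  induction n with
  | zero => simp
  | succ n ih =>
    have frob (f : K[X]) : FiniteField.frobeniusAlgHom F K[X] f = f ^ Fintype.card F := rfl
    have frobK (a : K) : FiniteField.frobeniusAlgHom F K a = a ^ Fintype.card F := rfl
    have key : (X : K[X]) ^ Fintype.card F ^ (n + 1) - X -
          C (∑ i ∈ Finset.range (n + 1), w ^ Fintype.card F ^ i) =
        (X ^ Fintype.card F ^ n - X - C (∑ i ∈ Finset.range n, w ^ Fintype.card F ^ i)) ^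
          Fintype.card F + (X ^ Fintype.card F - X - C w) := by
      rw [Finset.sum_range_succ', ← frob, map_sub, map_sub, frob, frob, frob, ← C_pow, ← frobK,
        map_sum]
      simp only [frobK, ← pow_mul, ← pow_succ, pow_zero, pow_one, C_add]
      ring
    rw [key]
    exact dvd_add (dvd_pow ih Fintype.card_ne_zero) dvd_rfl

theorem pow_card_pow_finrank_mul_eq_self (F : Type*) {K : Type*} [Field F] [Fintype F]
    [Field K] [Fintype K] [Algebra F K] (w : K) (k : ℕ) :
    w ^ Fintype.card F ^ (Module.finrank F K * k) = w := by
  rw [pow_mul, ← Module.card_eq_pow_finrank, FiniteField.pow_card_pow]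

/-- Summing the Frobenius conjugates over `k` full periods gives `k` times the trace. -/
theorem sum_range_mul_pow_card_pow_eq_nsmul_trace (F : Type*) {K : Type*} [Field F] [Fintype F]
    [Field K] [Fintype K] [Algebra F K] (w : K) (k : ℕ) :
    ∑ i ∈ Finset.range (Module.finrank F K * k), w ^ Fintype.card F ^ i =
      k • algebraMap F K (Algebra.trace F K w) := by
  induction k with
  | zero => simp
  | succ k ih =>
    rw [mul_add_one, Finset.sum_range_add, ih, succ_nsmul, FiniteField.algebraMap_trace_eq_sum_pow,
      Nat.card_eq_fintype_card]
    simp only [pow_add _ (Module.finrank F K * k), pow_mul w,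
      pow_card_pow_finrank_mul_eq_self]

/-- Let `s ≥ 1` and `k ≥ 1`, set `r = 1 + sk`, and let
`w, α ∈ F_{q^s}`.  Then `T^q − T − w` divides `T^{q^r} − T − α` in `F_{q^s}[T]` if and
only if `α = w + k·Tr_{F_{q^s}/F_q}(w)` (the integer `k` acting through the natural map
to the prime field). -/
theorem stmt16 (q s k : ℕ) (hs : 1 ≤ s) (hk : 1 ≤ k)
    (F K : Type*) [Field F] [Fintype F] [Field K] [Fintype K] [Algebra F K]
    (hF : Fintype.card F = q) (hK : Module.finrank F K = s)
    (w α : K) :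
    ((X : Polynomial K) ^ q - X - C w) ∣
        ((X : Polynomial K) ^ q ^ (1 + s * k) - X - C α) ↔
      α = w + k • algebraMap F K (Algebra.trace F K w) := by
  subst hF hK
  have hdvd := artinSchreier_dvd_X_pow_card_pow_sub_X_sub_C F w (1 + Module.finrank F K * k)
  have hsum : ∑ i ∈ Finset.range (1 + Module.finrank F K * k), w ^ Fintype.card F ^ i =
      w + k • algebraMap F K (Algebra.trace F K w) := by
    rw [add_comm 1, Finset.sum_range_succ, sum_range_mul_pow_card_pow_eq_nsmul_trace,
      pow_card_pow_finrank_mul_eq_self, add_comm]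
  rw [hsum] at hdvd
  refine ⟨fun h ↦ ?_, fun h ↦ h ▸ hdvd⟩
  have hconst := dvd_sub hdvd h
  rw [sub_sub_sub_cancel_left, ← C_sub] at hconst
  have hdeg : ((X : K[X]) ^ Fintype.card F - X - C w).natDegree = Fintype.card F := by
    rw [natDegree_sub_C]
    exact FiniteField.X_pow_card_sub_X_natDegree_eq K Fintype.one_lt_card
  have hzero := eq_zero_of_dvd_of_natDegree_lt hconst
    (by rw [hdeg, natDegree_C]; exact Fintype.card_pos)
  exact sub_eq_zero.mp (C_eq_zero.mp hzero)
end

section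
/- Let q = 2 and define F_i ∈ F_2[T] by F_0 = 1 and F_i = (−1)^i + (T^{2^i} − T)·F_{i−1} for i ≥ 1. Then every monic irreducible polynomial P ∈ F_2[T] of degree d ≥ 2 divides F_{d−1}; that is, every monic irreducible polynomial over F_2 other than T and T+1 is a c-Wieferich prime in F_2[T]. -/
open Polynomial

theorem two_eq_zero_polynomial_zmod_two : (2 : (ZMod 2)[X]) = 0 :=
  CharTwo.two_eq_zero

theorem Fseq_two_succ (i : ℕ) :
    Fseq 2 (ZMod 2) (i + 1) = 1 + (X ^ 2 ^ (i + 1) + X) * Fseq 2 (ZMod 2) i := by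
  rw [Fseq, CharTwo.neg_eq, one_pow, CharTwo.sub_eq_add]

/-- The coefficients `c i` of the Carlitz module polynomial `C_P(x) = ∑ c i * x ^ 2 ^ i` over `F_2`,
together with its value `C_P(1)`. -/
theorem exists_carlitz_coeff (N : ℕ) (P : (ZMod 2)[X]) (hP : P.natDegree ≤ N) :
    ∃ c : ℕ → (ZMod 2)[X], c 0 = P ∧
      (∀ i, (X ^ 2 ^ (i + 1) + X) * c (i + 1) = c i ^ 2 + c i) ∧
      c N = C (P.coeff N) ∧ (∀ i, N < i → c i = 0) ∧
      ∑ i ∈ Finset.range (N + 1), c i =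
        C (P.eval 0) + C (P.eval 0 + P.eval 1) * (X + 1) := by
  have h2 := two_eq_zero_polynomial_zmod_two
  have hsq (a : ZMod 2) : (C a : (ZMod 2)[X]) ^ 2 = C a := by
    rw [← C_pow, ZMod.pow_card]
  induction N generalizing P with
  | zero =>
    obtain ⟨a, rfl⟩ : ∃ a, P = C a := ⟨_, eq_C_of_natDegree_le_zero hP⟩
    refine ⟨fun i => if i = 0 then C a else 0, by simp, fun i => ?_, by simp, ?_, ?_⟩
    · rcases i with _ | i
      · simp [hsq, CharTwo.add_self_eq_zero]
      · simp
    · intro i hi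
      simp [hi.ne']
    · simp [CharTwo.add_self_eq_zero]
  | succ N ih =>
    obtain ⟨c, h0, hrec, hN, hlarge, hsum⟩ := ih P.divX (by
      rw [natDegree_divX_eq_natDegree_tsub_one]; omega)
    have hPeq := X_mul_divX_add P
    set Q := P.divX with hQ
    set a := P.coeff 0 with ha
    refine ⟨fun i => match i with
      | 0 => P
      | i + 1 => X ^ 2 ^ (i + 1) * c (i + 1) + c i, rfl, fun i => ?_, ?_, ?_, ?_⟩
    · rcases i with _ | i
      · have h := hrec 0
        simp only [zero_add, pow_one] at h ⊢
        rw [← hPeq, ← h0]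
        linear_combination X ^ 2 * h - hsq a + (c 0 * X ^ 2 - C a - X * c 0 * C a) * h2
      · have h := hrec (i + 1)
        have h' := hrec i
        simp only
        have e : (X : (ZMod 2)[X]) ^ 2 ^ (i + 1 + 1) = (X ^ 2 ^ (i + 1)) ^ 2 := by
          rw [← pow_mul, ← pow_succ]
        rw [e] at h ⊢
        set Y : (ZMod 2)[X] := X ^ 2 ^ (i + 1)
        linear_combination Y ^ 2 * h + h' +
          (Y ^ 2 * c (i + 1) - Y * c (i + 1) - Y * c (i + 1) * c i) * h2
    · simp [hlarge (N + 1) (by omega), hN, hQ, coeff_divX]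
    · intro i hi
      rcases i with _ | i
      · omega
      · simp [hlarge (i + 1) (by omega), hlarge i (by omega)]
    · have key (i : ℕ) : X ^ 2 ^ (i + 1) * c (i + 1) + c i = X * c (i + 1) + c i ^ 2 := by
        linear_combination hrec i + (c i - X * c (i + 1)) * h2
      rw [Finset.sum_range_succ']
      simp only [key]
      rw [Finset.sum_add_distrib, ← Finset.mul_sum, ← CharTwo.sum_sq, hsum]
      have hs : ∑ i ∈ Finset.range (N + 1), c (i + 1) =
          C (Q.eval 0) + C (Q.eval 0 + Q.eval 1) * (X + 1) + c 0 := by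
        have h := Finset.sum_range_succ' c (N + 1)
        rw [Finset.sum_range_succ, hsum, hlarge (N + 1) (by omega)] at h
        linear_combination -h - c 0 * h2
      rw [hs, ← hPeq, h0]
      simp only [eval_add, eval_mul, eval_X, eval_C, C_add, zero_mul, one_mul, C_0]
      have hα := hsq (Q.eval 0)
      have hβ := hsq (Q.eval 1)
      set α := C (Q.eval 0)
      set β := C (Q.eval 1)
      linear_combination (X + 2) ^ 2 * hα + (X + 1) ^ 2 * hβ +
        ((X + 2) * (X + 1) * α * β + (X ^ 2 + 3 * X + 2) * α + (X ^ 2 + X) * β + X * Q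
          - C a * (X + 1)) * h2

theorem eval_eq_one_of_irreducible {P : (ZMod 2)[X]} (hirr : Irreducible P)
    (hd : 2 ≤ P.natDegree) (a : ZMod 2) : P.eval a = 1 := by
  have h : P.eval a ≠ 0 := fun h => by
    have : P.natDegree = 1 := natDegree_eq_of_degree_eq_some (degree_eq_one_of_irreducible_of_root hirr h)
    omega
  exact Fin.eq_one_of_ne_zero _ h

theorem not_dvd_X_pow_two_pow_add_X {P : (ZMod 2)[X]} (hirr : Irreducible P) {i : ℕ}
    (hi : i ≠ 0) (hid : i < P.natDegree) : ¬ P ∣ X ^ 2 ^ i + X := by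
  intro h
  rw [← CharTwo.sub_eq_add] at h
  have h' : P ∣ X ^ Nat.card (ZMod 2) ^ i - X := by simpa using h
  exact hid.not_ge
    (Nat.le_of_dvd (Nat.pos_of_ne_zero hi) (hirr.natDegree_dvd_of_dvd_X_pow_card_pow_sub_X h'))

/-- For `q = 2`: every monic irreducible polynomial `P ∈ F_2[T]` of
degree `d ≥ 2` divides `F_{d−1}`; i.e. every monic irreducible polynomial over `F_2`
other than `T` and `T+1` is a c-Wieferich prime in `F_2[T]`. -/
theorem stmt18 (P : Polynomial (ZMod 2)) (hmon : P.Monic) (hirr : Irreducible P)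
    (hd : 2 ≤ P.natDegree) :
    P ∣ Fseq 2 (ZMod 2) (P.natDegree - 1) := by
  have h2 := two_eq_zero_polynomial_zmod_two
  have hprime := hirr.prime
  obtain ⟨c, h0, hrec, hN, -, hsum⟩ := exists_carlitz_coeff P.natDegree P le_rfl
  have hdvd : ∀ i, i < P.natDegree → P ∣ c i := by
    intro i
    induction i with
    | zero => exact fun _ => h0 ▸ dvd_rfl
    | succ i ih =>
      intro hi
      have hci := ih (by omega)
      have h : P ∣ (X ^ 2 ^ (i + 1) + X) * c (i + 1) := by
        rw [hrec]
        exact dvd_add (dvd_pow hci two_ne_zero) hci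
      exact (hprime.dvd_or_dvd h).resolve_left
        (not_dvd_X_pow_two_pow_add_X hirr i.succ_ne_zero hi)
  choose! e he using hdvd
  have he0 : e 0 = 1 := by
    have h := he 0 (by omega)
    rw [h0] at h
    exact mul_left_cancel₀ hirr.ne_zero (by rw [← h, mul_one])
  have herec (i : ℕ) (hi : i + 1 < P.natDegree) :
      (X ^ 2 ^ (i + 1) + X) * e (i + 1) = P * e i ^ 2 + e i := by
    have h := hrec i
    rw [he (i + 1) hi, he i (by omega)] at h
    exact mul_left_cancel₀ hirr.ne_zero (by linear_combination h)
  have hesum : ∑ i ∈ Finset.range P.natDegree, e i = 0 := by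
    rw [Finset.sum_range_succ, hN, hmon.coeff_natDegree,
      Finset.sum_congr rfl fun i hi => he i (Finset.mem_range.mp hi), ← Finset.mul_sum,
      eval_eq_one_of_irreducible hirr hd, eval_eq_one_of_irreducible hirr hd,
      CharTwo.add_self_eq_zero, C_0, zero_mul, add_zero, add_eq_right] at hsum
    exact (mul_eq_zero.mp hsum).resolve_left hirr.ne_zero
  have hndvd : ∀ i, i < P.natDegree → ¬ P ∣ e i := by
    intro i
    induction i with
    | zero => exact fun _ h => hirr.not_isUnit (isUnit_of_dvd_one (he0 ▸ h))
    | succ i ih =>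
      intro hi h
      refine ih (by omega) ((dvd_add_right (dvd_mul_right P (e i ^ 2))).mp ?_)
      exact herec i hi ▸ h.mul_left _
  have hF : ∀ i, i < P.natDegree →
      P ∣ e i * Fseq 2 (ZMod 2) i - ∑ j ∈ Finset.range (i + 1), e j := by
    intro i
    induction i with
    | zero => simp [he0, Fseq]
    | succ i ih =>
      intro hi
      obtain ⟨r, hr⟩ := ih (by omega)
      refine ⟨r + e i ^ 2 * Fseq 2 (ZMod 2) i, ?_⟩
      rw [Finset.sum_range_succ, Fseq_two_succ]
      linear_combination hr + Fseq 2 (ZMod 2) i * herec i hi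
  have h := hF (P.natDegree - 1) (by omega)
  rw [Nat.sub_add_cancel (by omega), hesum, sub_zero] at h
  exact (hprime.dvd_or_dvd h).resolve_left (hndvd _ (by omega))
end
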